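/- Let A = {1,…,k} with k ≥ 3 and let m ≥ 1. Then CONS_{k−1,1} together with the gate CC_m = 1-τ_{1^m, k^m} generates exactly the class of all mod-m-preserving gates: ⟨CONS_{k−1,1} ∪ {CC_m}⟩ equals the set of all reversible gates F over A such that c_k(F(w)) ≡ c_k(w) (mod m) for every input w. -/

import Mathlib

/-- A reversible gate function of arity `n` over alphabet `A`: a bijection `A^n → A^n`. -/
abbrev GateFun (A : Type*) (n : ℕ) := (Fin n → A) ≃ (Fin n → A)

/-- A reversible gate over alphabet `A`: an arity together with a bijection of that arity. -/
abbrev Gate (A : Type*) := Σ n : ℕ, GateFun A n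

/-- The canonical identification `A^{n+m} ≃ A^n × A^m`. -/
def splitEquiv (A : Type*) (n m : ℕ) :
    (Fin (n + m) → A) ≃ ((Fin n → A) × (Fin m → A)) :=
  (Equiv.arrowCongr finSumFinEquiv.symm (Equiv.refl A)).trans
    (Equiv.sumArrowEquivProdArrow _ _ A)

/-- The permutation gate `P_σ`, mapping `(a_1,…,a_n)` to `(a_{σ(1)},…,a_{σ(n)})`. -/
def permGate (A : Type*) {n : ℕ} (σ : Equiv.Perm (Fin n)) : GateFun A n :=
  Equiv.arrowCongr σ.symm (Equiv.refl A)

/-- Tensor product of gates. -/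
def tensorGate {A : Type*} {n m : ℕ} (F : GateFun A n) (G : GateFun A m) :
    GateFun A (n + m) :=
  ((splitEquiv A n m).trans (F.prodCongr G)).trans (splitEquiv A n m).symm

/-- The generation relation: `Generates S g` means `g` can be generated from the set `S`
of reversible gates using the permutation, tensor product, composition and ancilla rules. -/
inductive Generates {A : Type*} (S : Set (Gate A)) : Gate A → Prop
  | mem {g : Gate A} : g ∈ S → Generates S g
  | perm (n : ℕ) (σ : Equiv.Perm (Fin n)) : Generates S ⟨n, permGate A σ⟩
  | tensor {n m : ℕ} {F : GateFun A n} {G : GateFun A m} :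
      Generates S ⟨n, F⟩ → Generates S ⟨m, G⟩ → Generates S ⟨n + m, tensorGate F G⟩
  | comp {n : ℕ} {F G : GateFun A n} :
      Generates S ⟨n, F⟩ → Generates S ⟨n, G⟩ → Generates S ⟨n, G.trans F⟩
  | ancilla {l m : ℕ} {F : GateFun A (l + m)} (a : Fin l → A) {F' : GateFun A m} :
      Generates S ⟨l + m, F⟩ →
      (∀ b : Fin m → A,
        F ((splitEquiv A l m).symm (a, b)) = (splitEquiv A l m).symm (a, F' b)) →
      Generates S ⟨m, F'⟩

/-- The gate class `⟨S⟩` generated by a set `S` of reversible gates. -/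
def genClosure {A : Type*} (S : Set (Gate A)) : Set (Gate A) := {g | Generates S g}

/-- A reversible gate class: a set of gates closed under the generation rules. -/
def IsGateClass {A : Type*} (S : Set (Gate A)) : Prop := ∀ g, Generates S g → g ∈ S

/-- The transposition gate `τ_{u,v}` exchanging the inputs `u` and `v`. -/
def tau {A : Type*} [DecidableEq A] {n : ℕ} (u v : Fin n → A) : GateFun A n :=
  Equiv.swap u v

/-- The controlled gate `w-F`, mapping `w u` to `w F(u)` and fixing all other inputs. -/
def controlled {A : Type*} [DecidableEq A] {l n : ℕ} (w : Fin l → A) (F : GateFun A n) :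
    GateFun A (l + n) :=
  ((splitEquiv A l n).trans
    (Equiv.prodCongrRight fun p => if p = w then F else Equiv.refl _)).trans
    (splitEquiv A l n).symm

/-- `SWAP_{a,b}` for single symbols `a`, `b`: exchanges `ab` and `ba`. -/
def swapGate {A : Type*} [DecidableEq A] (a b : A) : GateFun A 2 :=
  tau ![a, b] ![b, a]

/-- Number of occurrences of the symbol `a` in the string `x`. -/
def countOf {A : Type*} [DecidableEq A] {n : ℕ} (a : A) (x : Fin n → A) : ℕ :=
  (Finset.univ.filter fun i => x i = a).card

/-- `c_k(x)`: the number of occurrences of the symbol `k` (the top element `⟨k-1,_⟩`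
of `Fin k`) in the string `x`. -/
def countLast {k n : ℕ} (x : Fin n → Fin k) : ℕ :=
  (Finset.univ.filter fun i => (x i : ℕ) = k - 1).card

/-- `CONS_{k-1,1}`: the class of reversible gates preserving the number of occurrences
of the symbol `k`. -/
def CONSk1 (k : ℕ) : Set (Gate (Fin k)) :=
  {g | ∀ w, countLast (g.2 w) = countLast w}

/-- The gate `CC_m = 1-τ_{1^m, k^m}`. -/
def CC (k m : ℕ) (hk : 0 < k) : Gate (Fin k) :=
  ⟨1 + m, controlled ![(⟨0, hk⟩ : Fin k)]
    (tau (fun _ : Fin m => (⟨0, hk⟩ : Fin k)) (fun _ => ⟨k - 1, by omega⟩))⟩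

theorem splitEquiv_symm_apply {A : Type*} {n m : ℕ} (a : Fin n → A) (b : Fin m → A) :
    (splitEquiv A n m).symm (a, b) = Fin.append a b := by
  funext i
  refine Fin.addCases (fun i => ?_) (fun i => ?_) i <;>
    simp [splitEquiv, Equiv.arrowCongr, Equiv.sumArrowEquivProdArrow]

theorem splitEquiv_append {A : Type*} {n m : ℕ} (a : Fin n → A) (b : Fin m → A) :
    splitEquiv A n m (Fin.append a b) = (a, b) := by
  rw [← splitEquiv_symm_apply, Equiv.apply_symm_apply]

theorem exists_eq_append {A : Type*} {n m : ℕ} (x : Fin (n + m) → A) :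
    ∃ a b, x = Fin.append a b :=
  ⟨_, _, (Fin.append_castAdd_natAdd (f := x)).symm⟩

theorem tensorGate_append {A : Type*} {n m : ℕ} (F : GateFun A n) (G : GateFun A m)
    (a : Fin n → A) (b : Fin m → A) :
    tensorGate F G (Fin.append a b) = Fin.append (F a) (G b) := by
  simp [tensorGate, splitEquiv_append, splitEquiv_symm_apply]

theorem controlled_append {A : Type*} [DecidableEq A] {l n : ℕ} (w : Fin l → A)
    (F : GateFun A n) (a : Fin l → A) (b : Fin n → A) :
    controlled w F (Fin.append a b) = Fin.append a (if a = w then F b else b) := by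
  by_cases h : a = w <;>
    simp [controlled, splitEquiv_append, splitEquiv_symm_apply, h]

theorem countLast_append {k n m : ℕ} (a : Fin n → Fin k) (b : Fin m → Fin k) :
    countLast (Fin.append a b) = countLast a + countLast b := by
  simp only [countLast, Finset.card_filter, Fin.sum_univ_add, Fin.append_left, Fin.append_right]

theorem countLast_permGate {k n : ℕ} (σ : Equiv.Perm (Fin n)) (x : Fin n → Fin k) :
    countLast (permGate (Fin k) σ x) = countLast x := by
  simp only [countLast, Finset.card_filter]
  exact Equiv.sum_comp σ fun i => if (x i : ℕ) = k - 1 then 1 else 0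

theorem countLast_const {k n : ℕ} (a : Fin k) :
    countLast (fun _ : Fin n => a) = if (a : ℕ) = k - 1 then n else 0 := by
  by_cases h : (a : ℕ) = k - 1 <;> simp [countLast, h]

theorem countLast_le {k n : ℕ} (x : Fin n → Fin k) : countLast x ≤ n := by
  simpa [countLast] using Finset.card_filter_le Finset.univ fun i => (x i : ℕ) = k - 1

theorem exists_countLast_eq {k n j : ℕ} (hk : 2 ≤ k) (hj : j ≤ n) :
    ∃ x : Fin n → Fin k, countLast x = j := by
  obtain ⟨i, rfl⟩ := Nat.exists_eq_add_of_le hj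
  refine ⟨Fin.append (fun _ => ⟨k - 1, by omega⟩) fun _ => ⟨0, by omega⟩, ?_⟩
  rw [countLast_append, countLast_const, countLast_const]
  simp
  omega

theorem apply_swap_eq {α β : Type*} [DecidableEq α] {f : α → β} {u v : α} (h : f u = f v)
    (x : α) : f (Equiv.swap u v x) = f x := by
  rw [Equiv.swap_apply_def]
  split_ifs with h₁ h₂ <;> simp_all

/-- Everything generated from mod-`m`-preserving gates is mod-`m`-preserving. -/
theorem Generates.countLast_modEq {k m : ℕ} {S : Set (Gate (Fin k))}
    (hS : ∀ g ∈ S, ∀ w, countLast (g.2 w) ≡ countLast w [MOD m]) {g : Gate (Fin k)}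
    (hg : Generates S g) : ∀ w, countLast (g.2 w) ≡ countLast w [MOD m] := by
  induction hg with
  | mem h => exact hS _ h
  | perm n σ => exact fun w => by rw [countLast_permGate]
  | tensor _ _ ihF ihG =>
    intro w
    obtain ⟨a, b, rfl⟩ := exists_eq_append w
    simp only [tensorGate_append, countLast_append]
    exact (ihF a).add (ihG b)
  | comp _ _ ihF ihG => exact fun w => (ihF _).trans (ihG w)
  | ancilla a _ hF ih =>
    intro b
    have h := ih (Fin.append a b)
    have hb := hF b
    simp only [splitEquiv_symm_apply] at hb
    simp only [hb, countLast_append] at h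
    exact Nat.ModEq.add_left_cancel' _ h

theorem controlled_countLast_modEq {k m l n : ℕ} (w : Fin l → Fin k) {F : GateFun (Fin k) n}
    (hF : ∀ x, countLast (F x) ≡ countLast x [MOD m]) (x : Fin (l + n) → Fin k) :
    countLast (controlled w F x) ≡ countLast x [MOD m] := by
  obtain ⟨a, b, rfl⟩ := exists_eq_append x
  rw [controlled_append, countLast_append, countLast_append]
  refine Nat.ModEq.add_left _ ?_
  split_ifs
  · exact hF b
  · rfl

theorem CC_countLast_modEq {k m : ℕ} (hk : 2 ≤ k) :
    ∀ w, countLast ((CC k m (by omega)).2 w) ≡ countLast w [MOD m] := by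
  refine controlled_countLast_modEq _ (apply_swap_eq (f := fun x => countLast x % m) ?_)
  simp [countLast_const, show 0 ≠ k - 1 by omega]

/-- The gates of arity `n` generated from `S`, as a subgroup. -/
def generatedSubgroup {A : Type*} [Finite A] (S : Set (Gate A)) (n : ℕ) :
    Subgroup (Equiv.Perm (Fin n → A)) :=
  let M : Submonoid (Equiv.Perm (Fin n → A)) :=
    { carrier := {F | Generates S ⟨n, F⟩}
      one_mem' := Generates.perm n 1
      mul_mem' := fun hF hG => Generates.comp hF hG }
  { M with
    inv_mem' := fun {F} hF => (Submonoid.powers_le (P := M)).2 hF <|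
      (isOfFinOrder_of_finite F).mem_powers_iff_mem_zpowers.2 <|
        inv_mem (Subgroup.mem_zpowers F) }

theorem Generates.cast {A : Type*} {S : Set (Gate A)} {n n' : ℕ} (h : n = n')
    {F : GateFun A n} (hF : Generates S ⟨n, F⟩) :
    Generates S ⟨n', (Equiv.arrowCongr (finCongr h) (Equiv.refl A)).permCongr F⟩ := by
  subst h
  exact hF

/-- Conserving gates turn the control symbol of `CC_m` into a control by an arbitrary string. -/
theorem generates_swap_append {k m l : ℕ} (hk : 3 ≤ k) (w : Fin l → Fin k) :
    Generates (CONSk1 k ∪ {CC k m (by omega)})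
      ⟨m + l, Equiv.swap (Fin.append (fun _ => ⟨0, by omega⟩) w)
        (Fin.append (fun _ => ⟨k - 1, by omega⟩) w)⟩ := by
  set S := CONSk1 k ∪ {CC k m (by omega)}
  let z : Fin 1 → Fin k := ![⟨0, by omega⟩]
  let o : Fin 1 → Fin k := ![⟨1, by omega⟩]
  have hoz : o ≠ z := fun h => by simpa [o, z] using congrFun h 0
  have hcount : countLast o = countLast z := by
    simp [countLast, o, z, show 0 ≠ k - 1 by omega, show 1 ≠ k - 1 by omega]
  let C : GateFun (Fin k) (1 + (m + l)) :=
    (splitEquiv (Fin k) 1 (m + l)).symm.permCongr <| Equiv.prodCongrLeft fun b =>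
      if (splitEquiv (Fin k) m l b).2 = w then Equiv.swap o z else 1
  have hC : ∀ a t v, C (Fin.append a (Fin.append t v)) =
      Fin.append (if v = w then Equiv.swap o z a else a) (Fin.append t v) := by
    intro a t v
    by_cases h : v = w <;>
      simp [C, Equiv.permCongr_apply, splitEquiv_append, splitEquiv_symm_apply, h]
  have hCgen : Generates S ⟨_, C⟩ := by
    refine Generates.mem (Or.inl fun x => ?_)
    obtain ⟨a, b, rfl⟩ := exists_eq_append x
    obtain ⟨t, v, rfl⟩ := exists_eq_append b
    simp only [hC, countLast_append]
    split_ifs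
    · rw [apply_swap_eq (f := countLast) hcount]
    · rfl
  let D := (Equiv.arrowCongr (finCongr (Nat.add_assoc 1 m l)) (Equiv.refl (Fin k))).permCongr
    (tensorGate (controlled z (tau (fun _ : Fin m => ⟨0, by omega⟩) fun _ => ⟨k - 1, by omega⟩))
      (permGate (Fin k) (1 : Equiv.Perm (Fin l))))
  have hDgen : Generates S ⟨_, D⟩ :=
    Generates.cast _ (Generates.tensor (Generates.mem (Or.inr rfl)) (Generates.perm l 1))
  have hD : ∀ a t v, D (Fin.append a (Fin.append t v)) = Fin.append a (Fin.append
      (if a = z then Equiv.swap (fun _ => ⟨0, by omega⟩) (fun _ => ⟨k - 1, by omega⟩) t else t)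
      v) := by
    intro a t v
    have hcast : ∀ a t v, (Equiv.arrowCongr (finCongr (Nat.add_assoc 1 m l))
        (Equiv.refl (Fin k))) (Fin.append (Fin.append a t) v) =
        Fin.append a (Fin.append t v) := by
      intro a t v
      rw [Fin.append_assoc]
      funext i
      simp [Equiv.arrowCongr]
    rw [← hcast a t v, Equiv.permCongr_apply, Equiv.symm_apply_apply, tensorGate_append]
    rw [show (permGate (Fin k) (1 : Equiv.Perm (Fin l))) v = v from rfl, controlled_append,
      hcast]
    rfl
  refine Generates.ancilla o (hCgen.comp (hDgen.comp hCgen)) fun b => ?_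
  obtain ⟨t, v, rfl⟩ := exists_eq_append b
  simp only [splitEquiv_symm_apply, Equiv.trans_apply, hC, hD]
  by_cases h : v = w
  · subst h
    simp only [if_true, Equiv.swap_apply_left, Equiv.swap_apply_right]
    congr 1
    have hinj : Function.Injective fun t : Fin m → Fin k => Fin.append t v := fun s t hst => by
      simpa [splitEquiv_append] using congrArg (splitEquiv (Fin k) m l) hst
    exact hinj.map_swap _ _ t
  · have hne : ∀ s, Fin.append t v ≠ Fin.append s w := fun s hs =>
      h (by simpa [splitEquiv_append] using congrArg (fun x => (splitEquiv (Fin k) m l x).2) hs)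
    simp [h, hoz, Equiv.swap_apply_of_ne_of_ne (hne _) (hne _)]

/-- Every mod-`m`-preserving gate is a product of generated transpositions. -/
theorem generates_of_modEq {k m n : ℕ} (hk : 3 ≤ k) (F : GateFun (Fin k) n)
    (hF : ∀ w, countLast (F w) ≡ countLast w [MOD m]) :
    Generates (CONSk1 k ∪ {CC k m (by omega)}) ⟨n, F⟩ := by
  set S := CONSk1 k ∪ {CC k m (by omega)}
  let T : Set (Equiv.Perm (Fin n → Fin k)) := {f | f.IsSwap ∧ Generates S ⟨n, f⟩}
  suffices h : F ∈ Subgroup.closure T from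
    (Subgroup.closure_le (generatedSubgroup S n)).2 (fun f hf => hf.2) h
  have hswap : ∀ x y, Generates S ⟨n, Equiv.swap x y⟩ →
      y ∈ MulAction.orbit (Subgroup.closure T) x := by
    intro x y h
    by_cases hxy : x = y
    · subst hxy
      exact MulAction.mem_orbit_self x
    · exact ⟨⟨_, Subgroup.subset_closure ⟨⟨x, y, hxy, rfl⟩, h⟩⟩, Equiv.swap_apply_left x y⟩
  have hlevel : ∀ x y : Fin n → Fin k, countLast x = countLast y →
      y ∈ MulAction.orbit (Subgroup.closure T) x := fun x y h =>
    hswap x y (Generates.mem (Or.inl (apply_swap_eq (f := countLast) h)))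
  have hstep : ∀ t (x y : Fin n → Fin k), countLast y = countLast x + m * t →
      y ∈ MulAction.orbit (Subgroup.closure T) x := by
    intro t
    induction t with
    | zero => exact fun x y h => hlevel x y (by simpa using h.symm)
    | succ t ih =>
      intro x y h
      have hy := countLast_le y
      rw [Nat.mul_succ] at h
      obtain ⟨l, rfl⟩ := Nat.exists_eq_add_of_le (show m ≤ n by omega)
      obtain ⟨w, hw⟩ := exists_countLast_eq (n := l) (show 2 ≤ k by omega)
        (show countLast x + m * t ≤ l by omega)
      have h₁ := ih x (Fin.append (fun _ => ⟨0, by omega⟩) w) (by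
        rw [countLast_append, countLast_const]
        simp [hw, show 0 ≠ k - 1 by omega])
      have h₂ := hswap _ _ (generates_swap_append (m := m) hk w)
      have h₃ := hlevel (Fin.append (fun _ => ⟨k - 1, by omega⟩) w) y (by
        rw [countLast_append, countLast_const]
        simp
        omega)
      rw [← MulAction.orbit_eq_iff] at h₁ h₂ h₃ ⊢
      rw [h₃, h₂, h₁]
  refine (_root_.mem_closure_isSwap fun f hf => hf.1).2 ⟨Set.toFinite _, fun x => ?_⟩
  rcases le_total (countLast x) (countLast (F x)) with h | h
  · obtain ⟨t, ht⟩ := (Nat.modEq_iff_dvd' h).1 (hF x).symm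
    exact hstep t _ _ (by omega)
  · obtain ⟨t, ht⟩ := (Nat.modEq_iff_dvd' h).1 (hF x)
    exact MulAction.mem_orbit_symm.1 (hstep t _ _ (by omega))

/-- Over `A = {1,…,k}` with `k ≥ 3` and `m ≥ 1`: `CONS_{k-1,1}` together with
`CC_m = 1-τ_{1^m,k^m}` generates exactly the class of all mod-`m`-preserving gates. -/
theorem closure_consk1_cc_eq_mod_preserving (k m : ℕ) (hk : 3 ≤ k) (hm : 1 ≤ m) :
    genClosure (CONSk1 k ∪ {CC k m (by omega)}) =
      {g : Gate (Fin k) | ∀ w, countLast (g.2 w) ≡ countLast w [MOD m]} := by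
  refine Set.Subset.antisymm (fun g hg => Generates.countLast_modEq ?_ hg)
    fun g hg => generates_of_modEq hk g.2 hg
  rintro g (hg | rfl) w
  · rw [hg w]
  · exact CC_countLast_modEq (by omega) w
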